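/- For each n ≥ 1 there is a dense open subset U ⊆ ℂ × ℂ^N such that for all (γ,λ) ∈ U, the image of the operator W^S_n(λ) on (ℂ^N)^{⊗n} equals S^n(ℂ^N), the space of symmetric tensors. -/

import Mathlib

open scoped BigOperators
open Complex Matrix Filter Topology

noncomputable section

namespace EllipticQG

/-- Jacobi's first theta function `θ(z) = -∑_{j ∈ ℤ+1/2} e^{πij²τ + 2πij(z+1/2)}`. -/
def theta (τ z : ℂ) : ℂ :=
  -∑' j : ℤ, Complex.exp ((Real.pi : ℂ) * Complex.I * ((j : ℂ) + 1 / 2) ^ 2 * τ +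
      2 * (Real.pi : ℂ) * Complex.I * ((j : ℂ) + 1 / 2) * (z + 1 / 2))

/-- `α(z,μ) = θ(z)θ(μ+γ)/(θ(z-γ)θ(μ))`. -/
def alphaF (τ γ z μ : ℂ) : ℂ :=
  theta τ z * theta τ (μ + γ) / (theta τ (z - γ) * theta τ μ)

/-- `β(z,μ) = -θ(z+μ)θ(γ)/(θ(z-γ)θ(μ))`. -/
def betaF (τ γ z μ : ℂ) : ℂ :=
  -(theta τ (z + μ) * theta τ γ) / (theta τ (z - γ) * theta τ μ)

/-- The elliptic dynamical R-matrix of `E_{τ,γ/2}(gl_N)` on `ℂ^N ⊗ ℂ^N`.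
Entry `((i,j),(k,l))` is the coefficient of `e_i ⊗ e_j` in `R (e_k ⊗ e_l)`. -/
def Rmat (N : ℕ) (τ γ z : ℂ) (lam : Fin N → ℂ) :
    Matrix (Fin N × Fin N) (Fin N × Fin N) ℂ := fun p q =>
  if p.1 = p.2 then (if q = p then 1 else 0)
  else (if q = p then alphaF τ γ z (lam p.1 - lam p.2) else 0) +
    (if q = (p.2, p.1) then betaF τ γ z (lam p.1 - lam p.2) else 0)

/-- `λ - γ ∑_{c ∈ S} h^{(c)}` evaluated on the configuration `g` of basis indices. -/
def shiftL {n N : ℕ} (γ : ℂ) (lam : Fin N → ℂ) (S : Finset (Fin n)) (g : Fin n → Fin N) :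
    Fin N → ℂ :=
  fun i => lam i - γ * ((S.filter fun c => g c = i).card : ℂ)

/-- `R(z, λ - γ ∑_{c∈S} h^{(c)})^{(a b)}` acting on `(ℂ^N)^{⊗ n}`. -/
def Rop (N n : ℕ) (τ γ z : ℂ) (lam : Fin N → ℂ) (S : Finset (Fin n)) (a b : Fin n) :
    Matrix (Fin n → Fin N) (Fin n → Fin N) ℂ := fun f g =>
  if ∀ c, c ≠ a → c ≠ b → f c = g c then
    Rmat N τ γ z (shiftL γ lam S g) (f a, f b) (g a, g b)
  else 0

/-- The operators `W_n(z,λ)`, defined recursively:  `W_1 = 1` and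
`W_{n+1}(z,λ) = R(z_1-z_2, λ-γ∑_{j=3}^{n+1}h^{(j)})^{(12)} ⋯ R(z_1-z_{n+1},λ)^{(1 n+1)}
  (1 ⊗ W_n(z_2,…,z_{n+1}, λ-γh^{(1)}))` (tensor factors indexed `0,…,n`). -/
def Wrec (N : ℕ) (τ γ : ℂ) : (n : ℕ) → (Fin n → ℂ) → (Fin N → ℂ) →
    Matrix (Fin n → Fin N) (Fin n → Fin N) ℂ
  | 0, _, _ => 1
  | n + 1, z, lam =>
    (((List.finRange n).map fun j : Fin n =>
      Rop N (n + 1) τ γ (z 0 - z j.succ) lam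
        (Finset.univ.filter fun c : Fin (n + 1) => j.succ < c) 0 j.succ).prod) *
      Matrix.of (fun f g : Fin (n + 1) → Fin N =>
        if f 0 = g 0 then
          Wrec N τ γ n (fun j => z j.succ) (fun i => lam i - if g 0 = i then γ else 0)
            (Fin.tail f) (Fin.tail g)
        else 0)

/-- `W^S_n(λ) = W_n(z^S, λ)` with `z^S = (0, γ, 2γ, …, (n-1)γ)`. -/
def WS (N n : ℕ) (τ γ : ℂ) (lam : Fin N → ℂ) :
    Matrix (Fin n → Fin N) (Fin n → Fin N) ℂ :=
  Wrec N τ γ n (fun j => ((j : ℕ) : ℂ) * γ) lam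

/-- `z^∧ = ((n-1)γ, …, 2γ, γ, 0)`. -/
def zWedge (n : ℕ) (γ : ℂ) : Fin n → ℂ := fun j => ((n - 1 - (j : ℕ) : ℕ) : ℂ) * γ

/-- `W^∧_n(λ) = lim_{z → z^∧} ∏_{j=1}^{n-1} (z_j - z_{j+1} - γ) · ρ W_n(z,λ) ρ`,
where `ρ` reverses the order of the tensor factors. -/
def Wwedge (N n : ℕ) (τ γ : ℂ) (lam : Fin N → ℂ) :
    Matrix (Fin n → Fin N) (Fin n → Fin N) ℂ :=
  limUnder (𝓝[≠] zWedge n γ) fun z : Fin n → ℂ =>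
    (∏ j : Fin n, if h : (j : ℕ) + 1 < n then z j - z ⟨(j : ℕ) + 1, h⟩ - γ else 1) •
      Matrix.of fun f g : Fin n → Fin N => Wrec N τ γ n z lam (f ∘ Fin.rev) (g ∘ Fin.rev)

/-- The space `S²(ℂ^N)` of symmetric tensors in `ℂ^N ⊗ ℂ^N`. -/
def symPair (N : ℕ) : Submodule ℂ ((Fin N × Fin N) → ℂ) where
  carrier := {v | ∀ p : Fin N × Fin N, v p = v (p.2, p.1)}
  add_mem' := by intro a b ha hb p; simp only [Pi.add_apply, ha p, hb p]
  zero_mem' := by intro p; rfl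
  smul_mem' := by intro c v hv p; simp only [Pi.smul_apply, hv p]

/-- `R^{reg}(γ,λ) = lim_{z→γ} (z-γ) R(z,λ)`. -/
def Rreg (N : ℕ) (τ γ : ℂ) (lam : Fin N → ℂ) : Matrix (Fin N × Fin N) (Fin N × Fin N) ℂ :=
  limUnder (𝓝[≠] γ) fun z : ℂ => (z - γ) • Rmat N τ γ z lam

/-- The flip `P : u ⊗ v ↦ v ⊗ u` on `ℂ^N ⊗ ℂ^N`. -/
def Pmat (N : ℕ) : Matrix (Fin N × Fin N) (Fin N × Fin N) ℂ := fun p q =>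
  if q = (p.2, p.1) then 1 else 0

/-- The space `S^n(ℂ^N)` of symmetric tensors in `(ℂ^N)^{⊗n}`. -/
def symTensors (N n : ℕ) : Submodule ℂ ((Fin n → Fin N) → ℂ) where
  carrier := {v | ∀ (σ : Equiv.Perm (Fin n)) (f : Fin n → Fin N), v (f ∘ σ) = v f}
  add_mem' := by intro a b ha hb σ f; simp only [Pi.add_apply, ha σ f, hb σ f]
  zero_mem' := by intro σ f; rfl
  smul_mem' := by intro c v hv σ f; simp only [Pi.smul_apply, hv σ f]

/-- `J_n(ℂ^N)`: the span of tensors `σ v - sign(σ) v`. -/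
def Jspan (N n : ℕ) : Submodule ℂ ((Fin n → Fin N) → ℂ) :=
  Submodule.span ℂ {w | ∃ (σ : Equiv.Perm (Fin n)) (v : (Fin n → Fin N) → ℂ),
    w = (fun f => v (f ∘ σ)) - ((Equiv.Perm.sign σ : ℤ) : ℂ) • v}

/-- `ℂ^N ⊗ W ⊆ ℂ^N ⊗ (ℂ^N)^{⊗ n}` for a subspace `W ⊆ (ℂ^N)^{⊗ n}`. -/
def consSlice (N n : ℕ) (W : Submodule ℂ ((Fin n → Fin N) → ℂ)) :
    Submodule ℂ ((Fin (n + 1) → Fin N) → ℂ) where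
  carrier := {v | ∀ i : Fin N, (fun g : Fin n → Fin N => v (Fin.cons i g)) ∈ W}
  add_mem' := by intro a b ha hb i; exact W.add_mem (ha i) (hb i)
  zero_mem' := by intro i; exact W.zero_mem
  smul_mem' := by intro c v hv i; exact W.smul_mem c (hv i)

/-- The `L`-operator of `V^{⊗n}(w)`:
`L(z,λ) = R(z-w, λ-γ∑_{j=2}^n h^{(j)})^{(01)} ⋯ R(z-w-γ(n-1), λ)^{(0n)}`,
acting on `ℂ^N ⊗ (ℂ^N)^{⊗n}` with factors numbered `0,…,n`. -/
def Lop (N n : ℕ) (τ γ z w : ℂ) (lam : Fin N → ℂ) :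
    Matrix (Fin (n + 1) → Fin N) (Fin (n + 1) → Fin N) ℂ :=
  ((List.finRange n).map fun j : Fin n =>
    Rop N (n + 1) τ γ (z - w - (j : ℕ) * γ) lam
      (Finset.univ.filter fun c : Fin (n + 1) => j.succ < c) 0 j.succ).prod

/-- The `L`-operator for the opposite coproduct:
`L'(z,λ) = R(z-w-γ(n-1), λ-γ∑_{j=1}^{n-1} h^{(j)})^{(0n)} ⋯ R(z-w, λ)^{(01)}`. -/
def Lop' (N n : ℕ) (τ γ z w : ℂ) (lam : Fin N → ℂ) :
    Matrix (Fin (n + 1) → Fin N) (Fin (n + 1) → Fin N) ℂ :=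
  (((List.finRange n).reverse).map fun j : Fin n =>
    Rop N (n + 1) τ γ (z - w - (j : ℕ) * γ) lam
      (Finset.univ.filter fun c : Fin (n + 1) => 0 < c ∧ c < j.succ) 0 j.succ).prod

/-- `Id ⊗ M` on `ℂ^N ⊗ (ℂ^N)^{⊗n}`. -/
def idTensor (N n : ℕ) (M : Matrix (Fin n → Fin N) (Fin n → Fin N) ℂ) :
    Matrix (Fin (n + 1) → Fin N) (Fin (n + 1) → Fin N) ℂ :=
  Matrix.of fun f g => if f 0 = g 0 then M (Fin.tail f) (Fin.tail g) else 0

/-- `Id ⊗ M(λ - γ h^{(0)})` on `ℂ^N ⊗ (ℂ^N)^{⊗n}`. -/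
def idTensorShift (N n : ℕ) (γ : ℂ)
    (M : (Fin N → ℂ) → Matrix (Fin n → Fin N) (Fin n → Fin N) ℂ) (lam : Fin N → ℂ) :
    Matrix (Fin (n + 1) → Fin N) (Fin (n + 1) → Fin N) ℂ :=
  Matrix.of fun f g =>
    if f 0 = g 0 then M (fun i => lam i - if g 0 = i then γ else 0) (Fin.tail f) (Fin.tail g)
    else 0

/-- The zero-weight symmetric tensor `e`: the sum of all `e_{i_1} ⊗ ⋯ ⊗ e_{i_n}` over
sequences in which each index occurs exactly `ℓ` times. -/
def evec (N n ℓ : ℕ) : (Fin n → Fin N) → ℂ := fun f =>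
  if ∀ i : Fin N, (Finset.univ.filter fun j => f j = i).card = ℓ then 1 else 0

/-- The multi-index of `ē = e_1^{⊗ℓ} ⊗ ⋯ ⊗ e_N^{⊗ℓ}`. -/
def barIdx (N ℓ : ℕ) : Fin (N * ℓ) → Fin N := fun j =>
  ⟨j.val / ℓ, by
    have h : (j : ℕ) < ℓ * N := by rw [Nat.mul_comm ℓ N]; exact j.isLt
    exact Nat.div_lt_of_lt_mul h⟩

/-- `g_{N,ℓ}(λ) = ∏_{1≤j<k≤N} ∏_{s=1}^ℓ θ(λ_j-λ_k+γs)/θ(λ_j-λ_k-γ(s-1))`. -/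
def gfun (N ℓ : ℕ) (τ γ : ℂ) (lam : Fin N → ℂ) : ℂ :=
  ∏ j : Fin N, ∏ k : Fin N,
    if j < k then
      ∏ s ∈ Finset.Icc 1 ℓ,
        theta τ (lam j - lam k + γ * (s : ℂ)) / theta τ (lam j - lam k - γ * ((s : ℂ) - 1))
    else 1

/-- The permutation induced by a word in the generators `s_1, …, s_n` of `S_{n+1}`:
`π_k = s_{a_1} ∘ ⋯ ∘ s_{a_k}` (letters `a` act as the transposition of `a` and `a+1`). -/
def permOfWord {n : ℕ} : List (Fin n) → Equiv.Perm (Fin (n + 1))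
  | [] => 1
  | a :: rest => Equiv.swap a.castSucc a.succ * permOfWord rest

/-- The product of R-matrices attached to a word (with accumulated permutation `π`):
`W_w(z,λ) = F_k ⋯ F_1` where for the `t`-th letter `a`
`F_t = R(z_{π(a)} - z_{π(a+1)}, λ - γ ∑_{b<a} h^{(π(b))})^{(π(a), π(a+1))}`,
`π = π_{t-1}` the permutation induced by the earlier letters. -/
def Wword (N : ℕ) {n : ℕ} (τ γ : ℂ) (z : Fin (n + 1) → ℂ) (lam : Fin N → ℂ) :
    List (Fin n) → Equiv.Perm (Fin (n + 1)) →
      Matrix (Fin (n + 1) → Fin N) (Fin (n + 1) → Fin N) ℂ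
  | [], _ => 1
  | a :: rest, π =>
      Wword N τ γ z lam rest (π * Equiv.swap a.castSucc a.succ) *
        Rop N (n + 1) τ γ (z (π a.castSucc) - z (π a.succ)) lam
          ((Finset.univ.filter fun c : Fin (n + 1) => (c : ℕ) < (a : ℕ)).image π)
          (π a.castSucc) (π a.succ)

/-- The fused R-matrix `𝓡_{V^{⊗m}(z), V^{⊗n}(w)}(λ)` on `(ℂ^N)^{⊗(m+n)}`
(first block: factors `0,…,m-1`; second block: factors `m,…,m+n-1`). -/
def Rmn (N m n : ℕ) (τ γ z w : ℂ) (lam : Fin N → ℂ) :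
    Matrix (Fin (m + n) → Fin N) (Fin (m + n) → Fin N) ℂ :=
  ((List.finRange m).map fun a : Fin m =>
    ((List.finRange n).map fun j : Fin n =>
      Rop N (m + n) τ γ (z + (a : ℕ) * γ - w - (j : ℕ) * γ) lam
        (Finset.univ.filter fun c : Fin (m + n) =>
          (c : ℕ) < (a : ℕ) ∨ m + (j : ℕ) < (c : ℕ))
        (Fin.castAdd n a) (Fin.natAdd m j)).prod).prod

/-- `A ⊗ B ⊆ (ℂ^N)^{⊗m} ⊗ (ℂ^N)^{⊗n}`, realised as `(A ⊗ V₂) ∩ (V₁ ⊗ B)`. -/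
def blockSub (N m n : ℕ) (A : Submodule ℂ ((Fin m → Fin N) → ℂ))
    (B : Submodule ℂ ((Fin n → Fin N) → ℂ)) :
    Submodule ℂ ((Fin (m + n) → Fin N) → ℂ) where
  carrier := {v |
    (∀ g : Fin n → Fin N, (fun f : Fin m → Fin N => v (Fin.append f g)) ∈ A) ∧
    ∀ f : Fin m → Fin N, (fun g : Fin n → Fin N => v (Fin.append f g)) ∈ B}
  add_mem' := by
    intro x y hx hy
    exact ⟨fun g => A.add_mem (hx.1 g) (hy.1 g), fun f => B.add_mem (hx.2 f) (hy.2 f)⟩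
  zero_mem' := ⟨fun _ => A.zero_mem, fun _ => B.zero_mem⟩
  smul_mem' := by
    intro c x hx
    exact ⟨fun g => A.smul_mem c (hx.1 g), fun f => B.smul_mem c (hx.2 f)⟩

/-- Matrix element `L_{jk}(z,λ)` of the `L`-operator (evaluation point `w = 0`),
as an operator on `(ℂ^N)^{⊗n}`: `L(z,λ)(e_k ⊗ v) = ∑_j e_j ⊗ L_{jk}(z,λ) v`. -/
def LmatEl (N n : ℕ) (τ γ z : ℂ) (lam : Fin N → ℂ) (j k : Fin N)
    (v : (Fin n → Fin N) → ℂ) : (Fin n → Fin N) → ℂ := fun g =>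
  (Lop N n τ γ z 0 lam).mulVec
    (fun f => (if f 0 = k then (1 : ℂ) else 0) * v (Fin.tail f)) (Fin.cons j g)

/-- `L_{j_{σ(1)} j_1}(z, λ-γ(ω_{j_2}+⋯+ω_{j_m})) ∘ ⋯ ∘ L_{j_{σ(m)} j_m}(z-(m-1)γ, λ)`. -/
def chainT (N n m : ℕ) (τ γ z : ℂ) (lam : Fin N → ℂ) (jt : Fin m → Fin N)
    (σ : Equiv.Perm (Fin m)) (v : (Fin n → Fin N) → ℂ) : (Fin n → Fin N) → ℂ :=
  (List.finRange m).foldr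
    (fun (t : Fin m) acc =>
      LmatEl N n τ γ (z - (t.val : ℂ) * γ)
        (fun i => lam i -
          γ * ((Finset.univ.filter fun s : Fin m => t < s ∧ jt s = i).card : ℂ))
        (jt (σ t)) (jt t) acc)
    v

/-- The transfer matrix `T_m(z)`, acting on scalar functions of `λ` via the identification
of the zero weight space of `S^{Nℓ}(ℂ^N)` with `ℂ` by the basis vector `e`:
`T_m(z) f(λ) = ∑_{j_1<⋯<j_m} ∑_{σ} (-1)^σ [L_{j_{σ(1)} j_1}(z,λ-γ(ω_{j_2}+⋯+ω_{j_m})) ⋯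
L_{j_{σ(m)} j_m}(z-(m-1)γ, λ)] e · f(λ-γ(ω_{j_1}+⋯+ω_{j_m}))`. -/
def Tm (N ℓ m : ℕ) (τ γ z : ℂ) (lam : Fin N → ℂ) (f : (Fin N → ℂ) → ℂ) : ℂ :=
  ∑ jt ∈ Finset.univ.filter fun jt : Fin m → Fin N => ∀ s t : Fin m, s < t → jt s < jt t,
    ∑ σ : Equiv.Perm (Fin m),
      ((Equiv.Perm.sign σ : ℤ) : ℂ) *
        chainT N (N * ℓ) m τ γ z lam jt σ (evec N (N * ℓ) ℓ) (barIdx N ℓ) *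
        f fun i => lam i - if ∃ t, jt t = i then γ else 0

/-- The `m`-th Ruijsenaars operator with coupling constant `ℓ`:
`M_m f(λ) = ∑_{|J|=m} ∏_{j∈J,k∉J} θ(λ_j-λ_k+ℓγ)/θ(λ_j-λ_k) · f(λ-γ∑_{j∈J}ω_j)`. -/
def Mm (N ℓ m : ℕ) (τ γ : ℂ) (f : (Fin N → ℂ) → ℂ) (lam : Fin N → ℂ) : ℂ :=
  ∑ J ∈ Finset.powersetCard m (Finset.univ : Finset (Fin N)),
    (∏ j ∈ J, ∏ k ∈ Jᶜ, theta τ (lam j - lam k + (ℓ : ℂ) * γ) / theta τ (lam j - lam k)) *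
      f fun i => lam i - if i ∈ J then γ else 0

/-- The transfer matrix with auxiliary space indexed by `ι` (weights `wt`) and quantum
space indexed by `ι₃`: `T f(λ) = ∑_μ tr_{W[μ]}(𝓡(λ)) f(λ-γμ)`. -/
def transferOp {N : ℕ} {ι ι₃ : Type} [Fintype ι] [Fintype ι₃] (γ : ℂ)
    (wt : ι → Fin N → ℂ) (R : (Fin N → ℂ) → Matrix (ι × ι₃) (ι × ι₃) ℂ)
    (f : (Fin N → ℂ) → ι₃ → ℂ) : (Fin N → ℂ) → ι₃ → ℂ := fun lam b =>
  ∑ a : ι, ∑ b' : ι₃, R lam (a, b) (a, b') * f (fun r => lam r - γ * wt a r) b'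

/-- The term of index `j` in the series defining `-θ(z)`. -/
def thetaTerm (τ z : ℂ) (j : ℤ) : ℂ :=
  Complex.exp ((Real.pi : ℂ) * Complex.I * ((j : ℂ) + 1 / 2) ^ 2 * τ +
      2 * (Real.pi : ℂ) * Complex.I * ((j : ℂ) + 1 / 2) * (z + 1 / 2))

theorem theta_eq_tsum (τ z : ℂ) : theta τ z = -∑' j, thetaTerm τ z j := rfl

theorem thetaTerm_eq (τ z : ℂ) (j : ℤ) : thetaTerm τ z j =
    Complex.exp (Real.pi * Complex.I * (τ / 4 + z + 1 / 2)) *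
      jacobiTheta₂_term j (z + 1 / 2 + τ / 2) τ := by
  rw [thetaTerm, jacobiTheta₂_term, ← Complex.exp_add]
  congr 1
  ring

theorem theta_eq_jacobiTheta₂ (τ z : ℂ) : theta τ z =
    -(Complex.exp (Real.pi * Complex.I * (τ / 4 + z + 1 / 2)) *
      jacobiTheta₂ (z + 1 / 2 + τ / 2) τ) := by
  rw [theta_eq_tsum, jacobiTheta₂, ← tsum_mul_left]
  simp_rw [thetaTerm_eq]

theorem summable_thetaTerm {τ : ℂ} (hτ : 0 < τ.im) (z : ℂ) : Summable (thetaTerm τ z) := by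
  have h := ((summable_jacobiTheta₂_term_iff (z + 1 / 2 + τ / 2) τ).2 hτ).mul_left
    (Complex.exp (Real.pi * Complex.I * (τ / 4 + z + 1 / 2)))
  exact h.congr fun j => (thetaTerm_eq τ z j).symm

theorem differentiable_theta {τ : ℂ} (hτ : 0 < τ.im) : Differentiable ℂ (theta τ) := by
  have h : theta τ = fun z => -(Complex.exp (Real.pi * Complex.I * (τ / 4 + z + 1 / 2)) *
      jacobiTheta₂ (z + 1 / 2 + τ / 2) τ) := funext (theta_eq_jacobiTheta₂ τ)
  rw [h]
  intro z
  have h1 : DifferentiableAt ℂ (fun z : ℂ => jacobiTheta₂ (z + 1 / 2 + τ / 2) τ) z :=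
    (differentiableAt_jacobiTheta₂_fst (z + 1 / 2 + τ / 2) hτ).comp z
      (f := fun z : ℂ => z + 1 / 2 + τ / 2) (by fun_prop)
  have h2 : DifferentiableAt ℂ
      (fun z : ℂ => Complex.exp (Real.pi * Complex.I * (τ / 4 + z + 1 / 2))) z := by fun_prop
  exact (h2.mul h1).neg

theorem continuous_theta {τ : ℂ} (hτ : 0 < τ.im) : Continuous (theta τ) :=
  (differentiable_theta hτ).continuous

/-- The term of index `u` in the even part of the doubled theta series. -/
def evenTerm (τ x : ℂ) (u : ℤ) : ℂ :=
  Complex.exp (2 * Real.pi * Complex.I * τ * u ^ 2 + 4 * Real.pi * Complex.I * u * x)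

/-- The term of index `u` in the odd part of the doubled theta series. -/
def oddTerm (τ x : ℂ) (u : ℤ) : ℂ :=
  Complex.exp (Real.pi * Complex.I * τ * (2 * u + 1) ^ 2 / 2 +
    2 * Real.pi * Complex.I * (2 * u + 1) * x)

theorem summable_evenTerm {τ : ℂ} (hτ : 0 < τ.im) (x : ℂ) : Summable (evenTerm τ x) := by
  have h := (summable_jacobiTheta₂_term_iff (2 * x) (2 * τ)).2 (by simpa using hτ)
  refine h.congr fun u => ?_
  rw [evenTerm, jacobiTheta₂_term]
  congr 1
  ring

theorem summable_oddTerm {τ : ℂ} (hτ : 0 < τ.im) (x : ℂ) : Summable (oddTerm τ x) := by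
  have h := ((summable_jacobiTheta₂_term_iff (2 * x + τ) (2 * τ)).2 (by simpa using hτ)).mul_left
    (Complex.exp (Real.pi * Complex.I * τ / 2 + 2 * Real.pi * Complex.I * x))
  refine h.congr fun u => ?_
  rw [oddTerm, jacobiTheta₂_term, ← Complex.exp_add]
  congr 1
  ring

/-- Pairs of integers, split according to the parity of their difference. -/
def intPairParityEquiv : (ℤ × ℤ) ⊕ (ℤ × ℤ) ≃ ℤ × ℤ :=
  Equiv.ofBijective
    (Sum.elim (fun p => (p.1 + p.2, p.1 - p.2)) (fun p => (p.1 + p.2, p.1 - p.2 - 1))) (by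
      constructor
      · rintro (⟨a, b⟩ | ⟨a, b⟩) (⟨c, d⟩ | ⟨c, d⟩) h <;>
          simp only [Sum.elim_inl, Sum.elim_inr, Prod.mk.injEq, Sum.inl.injEq, Sum.inr.injEq,
            reduceCtorEq] at h ⊢ <;> omega
      · rintro ⟨a, b⟩
        rcases Int.even_or_odd' (a - b) with ⟨v, hv | hv⟩
        · exact ⟨Sum.inl (a - v, v), by simp; omega⟩
        · exact ⟨Sum.inr (a - v, v), by simp; omega⟩)

theorem thetaTerm_mul_inl (τ x y : ℂ) (p : ℤ × ℤ) :
    thetaTerm τ (x + y) (p.1 + p.2) * thetaTerm τ (x - y) (p.1 - p.2) =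
      -(oddTerm τ x p.1 * evenTerm τ y p.2) := by
  have h : (-1 : ℂ) = Complex.exp (Real.pi * Complex.I + p.1 * (2 * Real.pi * Complex.I)) := by
    rw [Complex.exp_add, Complex.exp_int_mul_two_pi_mul_I, Complex.exp_pi_mul_I, mul_one]
  rw [← neg_one_mul, h, thetaTerm, thetaTerm, oddTerm, evenTerm, ← Complex.exp_add,
    ← Complex.exp_add, ← Complex.exp_add]
  congr 1
  push_cast
  ring

theorem thetaTerm_mul_inr (τ x y : ℂ) (p : ℤ × ℤ) :
    thetaTerm τ (x + y) (p.1 + p.2) * thetaTerm τ (x - y) (p.1 - p.2 - 1) =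
      evenTerm τ x p.1 * oddTerm τ y p.2 := by
  have h : (1 : ℂ) = Complex.exp (p.1 * (2 * Real.pi * Complex.I)) := by
    rw [Complex.exp_int_mul_two_pi_mul_I]
  rw [← one_mul (evenTerm τ x p.1 * _), h, thetaTerm, thetaTerm, oddTerm, evenTerm,
    ← Complex.exp_add, ← Complex.exp_add, ← Complex.exp_add]
  congr 1
  push_cast
  ring

theorem theta_add_mul_theta_sub {τ : ℂ} (hτ : 0 < τ.im) (x y : ℂ) :
    theta τ (x + y) * theta τ (x - y) =
      (∑' u, evenTerm τ x u) * (∑' u, oddTerm τ y u) -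
        (∑' u, oddTerm τ x u) * (∑' u, evenTerm τ y u) := by
  have he := fun x => (summable_evenTerm hτ x).norm
  have ho := fun x => (summable_oddTerm hτ x).norm
  have ht := fun x => (summable_thetaTerm hτ x).norm
  have hs := summable_mul_of_summable_norm (ht (x + y)) (ht (x - y))
  rw [theta_eq_tsum, theta_eq_tsum, neg_mul_neg, tsum_mul_tsum_of_summable_norm (ht _) (ht _),
    tsum_mul_tsum_of_summable_norm (he _) (ho _), tsum_mul_tsum_of_summable_norm (ho _) (he _),
    ← intPairParityEquiv.tsum_eq]
  have hs' := intPairParityEquiv.summable_iff.2 hs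
  have h1 := hs'.comp_injective Sum.inl_injective
  have h2 := hs'.comp_injective Sum.inr_injective
  have key := (h1.hasSum.sum h2.hasSum).tsum_eq
  refine Eq.trans key ?_
  rw [sub_eq_neg_add (∑' z : ℤ × ℤ, evenTerm τ x z.1 * oddTerm τ y z.2), ← tsum_neg]
  exact congrArg₂ (· + ·) (tsum_congr fun p => thetaTerm_mul_inl τ x y p)
    (tsum_congr fun p => thetaTerm_mul_inr τ x y p)

theorem exists_theta_ne_zero {τ : ℂ} (hτ : 0 < τ.im) : ∃ z, theta τ z ≠ 0 := by
  by_contra! h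
  have hJ : ∀ z, jacobiTheta₂ z τ = 0 := fun z => by
    have := h (z - 1 / 2 - τ / 2)
    rw [theta_eq_jacobiTheta₂, neg_eq_zero, mul_eq_zero] at this
    have h3 := this.resolve_left (Complex.exp_ne_zero _)
    rwa [show z - 1 / 2 - τ / 2 + 1 / 2 + τ / 2 = z by ring] at h3
  let f : ℤ → C(ℝ, ℂ) := fun n => ⟨fun x => jacobiTheta₂_term n x τ, by
    unfold jacobiTheta₂_term; fun_prop⟩
  have hnorm : ∀ (n : ℤ) (x : ℝ), ‖f n x‖ = ‖jacobiTheta₂_term n 0 τ‖ := fun n x => by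
    simp [f, norm_jacobiTheta₂_term]
  have hsum : Summable fun n => ‖(f n).restrict
      (⟨Set.uIcc (0 : ℝ) 1, isCompact_uIcc⟩ : TopologicalSpace.Compacts ℝ)‖ := by
    refine Summable.of_nonneg_of_le (fun _ => norm_nonneg _) (fun n => ?_)
      ((summable_jacobiTheta₂_term_iff 0 τ).2 hτ).norm
    exact (ContinuousMap.norm_le _ (norm_nonneg _)).2 fun x => (hnorm n x).le
  have hI := intervalIntegral.hasSum_intervalIntegral_of_summable_norm hsum
  have h0 : ∀ x : ℝ, ∑' n, f n x = 0 := fun x => hJ x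
  simp_rw [h0, intervalIntegral.integral_zero] at hI
  have hne : ∀ n : ℤ, n ≠ 0 → ∫ x in (0 : ℝ)..1, f n x = 0 := by
    intro n hn
    have hc : (2 * Real.pi * Complex.I * n : ℂ) ≠ 0 := by
      simp [Real.pi_ne_zero, hn]
    have hf : ∀ x : ℝ, f n x =
        Complex.exp (2 * Real.pi * Complex.I * n * x) *
          Complex.exp (Real.pi * Complex.I * n ^ 2 * τ) := fun x => by
      rw [← Complex.exp_add]; rfl
    simp_rw [hf]
    rw [intervalIntegral.integral_mul_const, integral_exp_mul_complex hc]
    have h1 : Complex.exp (2 * Real.pi * Complex.I * n * (1 : ℝ)) = 1 := by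
      rw [← Complex.exp_int_mul_two_pi_mul_I n]
      congr 1
      push_cast
      ring
    rw [h1]
    simp
  have h1 : ∫ x in (0 : ℝ)..1, f 0 x = 1 := by
    have : ∀ x : ℝ, f 0 x = 1 := fun x => by simp [f, jacobiTheta₂_term]
    simp [this]
  have := hI.unique (hasSum_single 0 hne)
  rw [h1] at this
  exact zero_ne_one this

theorem theta_neg {τ : ℂ} (hτ : 0 < τ.im) (z : ℂ) : theta τ (-z) = -theta τ z := by
  obtain ⟨s, hs⟩ := exists_theta_ne_zero hτ
  have h1 := theta_add_mul_theta_sub hτ ((s + z) / 2) ((s - z) / 2)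
  have h2 := theta_add_mul_theta_sub hτ ((s - z) / 2) ((s + z) / 2)
  rw [show (s + z) / 2 + (s - z) / 2 = s by ring, show (s + z) / 2 - (s - z) / 2 = z by ring] at h1
  rw [show (s - z) / 2 + (s + z) / 2 = s by ring,
    show (s - z) / 2 - (s + z) / 2 = -z by ring] at h2
  apply mul_left_cancel₀ hs
  linear_combination h1 + h2

theorem theta_zero {τ : ℂ} (hτ : 0 < τ.im) : theta τ 0 = 0 := by
  have h := theta_neg hτ 0
  rw [neg_zero] at h
  linear_combination h / 2

/-- The three-term (Weierstrass) identity. -/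
theorem theta_three_term {τ : ℂ} (hτ : 0 < τ.im) (x y z w : ℂ) :
    theta τ (x + y) * theta τ (x - y) * (theta τ (z + w) * theta τ (z - w)) =
      theta τ (x + z) * theta τ (x - z) * (theta τ (y + w) * theta τ (y - w)) -
        theta τ (x + w) * theta τ (x - w) * (theta τ (y + z) * theta τ (y - z)) := by
  simp only [theta_add_mul_theta_sub hτ]
  ring

theorem eventually_theta_ne_zero {τ : ℂ} (hτ : 0 < τ.im) (z : ℂ) :
    ∀ᶠ w in 𝓝[≠] z, theta τ w ≠ 0 := by
  have ha : AnalyticOnNhd ℂ (theta τ) Set.univ := fun w _ => (differentiable_theta hτ).analyticAt w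
  refine (ha z trivial).eventually_eq_zero_or_eventually_ne_zero.resolve_left fun h => ?_
  obtain ⟨s, hs⟩ := exists_theta_ne_zero hτ
  exact hs (ha.eqOn_zero_of_preconnected_of_frequently_eq_zero isPreconnected_univ
    (Set.mem_univ z) (h.filter_mono nhdsWithin_le_nhds).frequently (Set.mem_univ s))

theorem dense_theta_ne_zero {τ : ℂ} (hτ : 0 < τ.im) : Dense {z | theta τ z ≠ 0} := fun z =>
  mem_closure_iff_frequently.2
    ((eventually_theta_ne_zero hτ z).frequently.filter_mono nhdsWithin_le_nhds)

/-- The sum `∑_i ∏_j θ(x_i - y_j) / ∏_{j ≠ i} θ(x_i - x_j)`. -/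
def thetaSum {ι : Type*} [DecidableEq ι] (τ : ℂ) (s : Finset ι) (x y : ι → ℂ) : ℂ :=
  ∑ i ∈ s, (∏ j ∈ s, theta τ (x i - y j)) / ∏ j ∈ s.erase i, theta τ (x i - x j)

theorem thetaSum_mul_of_insert {ι : Type*} [DecidableEq ι] {τ : ℂ} (hτ : 0 < τ.im)
    {t : Finset ι} {a : ι} (ha : a ∉ t) {x : ι → ℂ}
    (hx : ∀ i ∈ t, theta τ (x i - x a) ≠ 0) (p : ι → ℂ) :
    ∑ i ∈ insert a t, theta τ (x i - x a) * p i / ∏ j ∈ (insert a t).erase i, theta τ (x i - x j) =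
      ∑ i ∈ t, p i / ∏ j ∈ t.erase i, theta τ (x i - x j) := by
  rw [Finset.sum_insert ha, sub_self, theta_zero hτ, zero_mul, zero_div, zero_add]
  refine Finset.sum_congr rfl fun i hi => ?_
  have hia : a ≠ i := fun h => ha (h ▸ hi)
  rw [Finset.erase_insert_of_ne hia, Finset.prod_insert (fun h => ha (Finset.mem_of_mem_erase h)),
    mul_div_mul_left _ _ (hx i hi)]

theorem thetaSum_insert_insert {ι : Type*} [DecidableEq ι] {τ : ℂ} (hτ : 0 < τ.im)
    {t : Finset ι} {a b : ι} (ha : a ∉ insert b t) (hb : b ∉ t) {x y : ι → ℂ}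
    (hx : ∀ i ∈ insert a (insert b t), ∀ j ∈ insert a (insert b t), i ≠ j →
      theta τ (x i - x j) ≠ 0)
    (h1 : thetaSum τ (insert b t) x (Function.update y b (y a + y b - x a)) = 0)
    (h2 : thetaSum τ (insert a t) x (Function.update y a (y a + y b - x b)) = 0)
    (hne : theta τ (x a + x b - (y a + y b)) ≠ 0) :
    thetaSum τ (insert a (insert b t)) x y = 0 := by
  have hab : a ≠ b := fun h => ha (h ▸ Finset.mem_insert_self _ _)
  have hat : a ∉ t := fun h => ha (Finset.mem_insert_of_mem h)
  have hΔ : theta τ (x a + x b - (y a + y b)) * theta τ (x a - x b) ≠ 0 :=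
    mul_ne_zero hne (hx a (by simp) b (by simp) hab)
  have hba : b ∉ insert a t := by simp [hab.symm, hb]
  set c := (y a - y b) / 2 with hc
  set c₁ := x a - (y a + y b) / 2 with hc₁
  set c₂ := x b - (y a + y b) / 2 with hc₂
  have hu : ∀ i, ∏ j ∈ t, theta τ (x i - Function.update y b (y a + y b - x a) j) =
      ∏ j ∈ t, theta τ (x i - y j) := fun i => Finset.prod_congr rfl fun j hj => by
    rw [Function.update_of_ne (ne_of_mem_of_not_mem hj hb)]
  have hv : ∀ i, ∏ j ∈ t, theta τ (x i - Function.update y a (y a + y b - x b) j) =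
      ∏ j ∈ t, theta τ (x i - y j) := fun i => Finset.prod_congr rfl fun j hj => by
    rw [Function.update_of_ne (ne_of_mem_of_not_mem hj hat)]
  have e1 := thetaSum_mul_of_insert hτ ha (x := x)
    (fun i hi => hx i (Finset.mem_insert_of_mem hi) a (by simp) fun h => ha (h ▸ hi))
    (fun i => theta τ (x i - (y a + y b - x a)) * ∏ j ∈ t, theta τ (x i - y j))
  have e2 := thetaSum_mul_of_insert hτ hba (x := x)
    (fun i hi => hx i (by rw [Finset.insert_comm]; exact Finset.mem_insert_of_mem hi) b (by simp)
      fun h => hba (h ▸ hi))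
    (fun i => theta τ (x i - (y a + y b - x b)) * ∏ j ∈ t, theta τ (x i - y j))
  unfold thetaSum at h1 h2
  simp only [Finset.prod_insert hb, Finset.prod_insert hat, Function.update_self, hu, hv] at h1 h2
  rw [h1] at e1
  rw [h2, Finset.insert_comm] at e2
  refine (mul_eq_zero_iff_right hΔ).1 ?_
  rw [thetaSum, Finset.sum_mul]
  have hterm : ∀ i ∈ insert a (insert b t),
      (∏ j ∈ insert a (insert b t), theta τ (x i - y j)) /
        (∏ j ∈ (insert a (insert b t)).erase i, theta τ (x i - x j)) *
        (theta τ (x a + x b - (y a + y b)) * theta τ (x a - x b)) =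
      theta τ (c + c₂) * theta τ (c - c₂) *
        (theta τ (x i - x a) * (theta τ (x i - (y a + y b - x a)) *
          ∏ j ∈ t, theta τ (x i - y j)) /
            ∏ j ∈ (insert a (insert b t)).erase i, theta τ (x i - x j)) -
      theta τ (c + c₁) * theta τ (c - c₁) *
        (theta τ (x i - x b) * (theta τ (x i - (y a + y b - x b)) *
          ∏ j ∈ t, theta τ (x i - y j)) /
            ∏ j ∈ (insert a (insert b t)).erase i, theta τ (x i - x j)) := by
    intro i _
    have h3 := theta_three_term hτ (x i - (y a + y b) / 2) c c₁ c₂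
    rw [show x i - (y a + y b) / 2 + c = x i - y b by rw [hc]; ring,
      show x i - (y a + y b) / 2 - c = x i - y a by rw [hc]; ring,
      show x i - (y a + y b) / 2 + c₁ = x i - (y a + y b - x a) by rw [hc₁]; ring,
      show x i - (y a + y b) / 2 - c₁ = x i - x a by rw [hc₁]; ring,
      show x i - (y a + y b) / 2 + c₂ = x i - (y a + y b - x b) by rw [hc₂]; ring,
      show x i - (y a + y b) / 2 - c₂ = x i - x b by rw [hc₂]; ring,
      show c₁ + c₂ = x a + x b - (y a + y b) by rw [hc₁, hc₂]; ring,
      show c₁ - c₂ = x a - x b by rw [hc₁, hc₂]; ring] at h3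
    rw [Finset.prod_insert ha, Finset.prod_insert hb]
    linear_combination ((∏ j ∈ t, theta τ (x i - y j)) /
      (∏ j ∈ (insert a (insert b t)).erase i, theta τ (x i - x j))) * h3
  rw [Finset.sum_congr rfl hterm, Finset.sum_sub_distrib, ← Finset.mul_sum, ← Finset.mul_sum,
    e1, e2]
  ring

/-- The elliptic partial fraction identity. -/
theorem thetaSum_eq_zero {ι : Type*} [DecidableEq ι] {τ : ℂ} (hτ : 0 < τ.im) (s : Finset ι) :
    ∀ {x y : ι → ℂ}, (∀ i ∈ s, ∀ j ∈ s, i ≠ j → theta τ (x i - x j) ≠ 0) →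
      ∑ i ∈ s, x i = ∑ i ∈ s, y i → thetaSum τ s x y = 0 := by
  induction hn : s.card using Nat.strong_induction_on generalizing s with
  | _ n ih =>
  intro x y hx hxy
  obtain rfl | ⟨a, has⟩ := s.eq_empty_or_nonempty
  · simp [thetaSum]
  obtain ⟨s', ha, rfl⟩ : ∃ s', a ∉ s' ∧ insert a s' = s :=
    ⟨s.erase a, Finset.notMem_erase _ _, Finset.insert_erase has⟩
  obtain rfl | ⟨b, hbs⟩ := s'.eq_empty_or_nonempty
  · simp only [insert_empty_eq, Finset.sum_singleton] at hxy
    simp [thetaSum, hxy, theta_zero hτ]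
  obtain ⟨t, hb, rfl⟩ : ∃ t, b ∉ t ∧ insert b t = s' :=
    ⟨s'.erase b, Finset.notMem_erase _ _, Finset.insert_erase hbs⟩
  have hab : a ≠ b := fun h => ha (h ▸ Finset.mem_insert_self _ _)
  have hat : a ∉ t := fun h => ha (Finset.mem_insert_of_mem h)
  rw [Finset.card_insert_of_notMem ha, Finset.card_insert_of_notMem hb] at hn
  obtain rfl | ⟨e, het⟩ := t.eq_empty_or_nonempty
  · simp only [insert_empty_eq, Finset.sum_pair hab] at hxy
    have h1 : (insert a (insert b ∅) : Finset ι).erase a = {b} := by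
      rw [Finset.erase_insert ha, insert_empty_eq]
    have h2 : (insert a (insert b ∅) : Finset ι).erase b = {a} := by
      rw [Finset.insert_comm, Finset.erase_insert (by simp [hab.symm]), insert_empty_eq]
    rw [thetaSum, Finset.sum_insert ha, Finset.sum_insert hb, h1, h2]
    simp only [insert_empty_eq, Finset.prod_pair hab, Finset.prod_singleton, Finset.sum_empty]
    rw [show x b - y a = -(x a - y b) by linear_combination hxy,
      show x b - y b = -(x a - y a) by linear_combination hxy,
      show x b - x a = -(x a - x b) by ring, theta_neg hτ, theta_neg hτ, theta_neg hτ, div_neg]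
    ring
  have hae : a ≠ e := fun h => hat (h ▸ het)
  have hbe : b ≠ e := fun h => hb (h ▸ het)
  let yε : ℂ → ι → ℂ := fun ε i => y i + (if i = a then ε else 0) - (if i = e then ε else 0)
  have hcont : Continuous fun ε => thetaSum τ (insert a (insert b t)) x (yε ε) := by
    have hθ := continuous_theta hτ
    have hy : ∀ i, Continuous fun ε => yε ε i := fun i => by
      refine (continuous_const.add ?_).sub ?_ <;> split_ifs <;> fun_prop
    unfold thetaSum
    refine continuous_finsetSum _ fun i _ => Continuous.div_const ?_ _
    exact continuous_finsetProd _ fun j _ => hθ.comp (continuous_const.sub (hy j))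
  have hev : ∀ᶠ ε in 𝓝[≠] (0 : ℂ), theta τ (x a + x b - (y a + y b) - ε) ≠ 0 := by
    have h := eventually_theta_ne_zero hτ (x a + x b - (y a + y b))
    have ht : Tendsto (fun ε : ℂ => x a + x b - (y a + y b) - ε) (𝓝[≠] 0)
        (𝓝[≠] (x a + x b - (y a + y b))) := by
      refine tendsto_nhdsWithin_iff.2 ⟨?_, ?_⟩
      · have : Continuous fun ε : ℂ => x a + x b - (y a + y b) - ε := by fun_prop
        simpa using (this.tendsto 0).mono_left nhdsWithin_le_nhds
      · filter_upwards [self_mem_nhdsWithin] with ε hε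
        simpa using hε
    exact ht.eventually h
  have hzero : ∀ᶠ ε in 𝓝[≠] (0 : ℂ), thetaSum τ (insert a (insert b t)) x (yε ε) = 0 := by
    filter_upwards [hev] with ε hε
    have hsum : ∑ i ∈ insert a (insert b t), yε ε i = ∑ i ∈ insert a (insert b t), y i := by
      simp only [yε, Finset.sum_sub_distrib, Finset.sum_add_distrib, Finset.sum_ite_eq']
      simp [het]
    rw [← hsum] at hxy
    rw [Finset.sum_insert ha, Finset.sum_insert ha, Finset.sum_insert hb, Finset.sum_insert hb]
      at hxy
    refine thetaSum_insert_insert hτ ha hb hx ?_ ?_ ?_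
    · refine ih _ ?_ (insert b t) rfl (fun i hi j hj => hx i (Finset.mem_insert_of_mem hi) j
        (Finset.mem_insert_of_mem hj)) ?_
      · rw [Finset.card_insert_of_notMem hb]; omega
      · rw [Finset.sum_insert hb, Finset.sum_insert hb, Function.update_self,
          Finset.sum_update_of_notMem hb]
        linear_combination hxy
    · refine ih _ ?_ (insert a t) rfl (fun i hi j hj => hx i ?_ j ?_) ?_
      · rw [Finset.card_insert_of_notMem hat]; omega
      · rw [Finset.insert_comm]; exact Finset.mem_insert_of_mem hi
      · rw [Finset.insert_comm]; exact Finset.mem_insert_of_mem hj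
      · rw [Finset.sum_insert hat, Finset.sum_insert hat, Function.update_self,
          Finset.sum_update_of_notMem hat]
        linear_combination hxy
    · convert hε using 2
      simp only [yε, if_true, if_neg hae, if_neg hbe, if_neg hab.symm]
      ring
  have hlim := (hcont.tendsto 0).mono_left (nhdsWithin_le_nhds (s := {0}ᶜ))
  have h0 : yε 0 = y := by funext i; simp [yε]
  rw [h0] at hlim
  exact tendsto_nhds_unique hlim (tendsto_const_nhds.congr' (hzero.mono fun _ h => h.symm))

/-- `λ - γ ω_p`. -/
def lamShift {N : ℕ} (γ : ℂ) (lam : Fin N → ℂ) (p : Fin N) : Fin N → ℂ :=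
  fun i => lam i - if p = i then γ else 0

theorem lamShift_self {N : ℕ} (γ : ℂ) (lam : Fin N → ℂ) (p : Fin N) :
    lamShift γ lam p p = lam p - γ := by simp [lamShift]

theorem lamShift_of_ne {N : ℕ} (γ : ℂ) (lam : Fin N → ℂ) {p i : Fin N} (h : p ≠ i) :
    lamShift γ lam p i = lam i := by simp [lamShift, h]

/-- The theta values met in `W^S_n`, `n ≤ B + 1`, do not vanish at `(γ, λ)`. -/
structure ThetaGeneric {N : ℕ} (τ γ : ℂ) (lam : Fin N → ℂ) (B : ℕ) : Prop where
  gamma_ne : ∀ j : ℕ, 1 ≤ j → j ≤ B + 1 → theta τ (j * γ) ≠ 0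
  lam_ne : ∀ k p : Fin N, k ≠ p → ∀ j : ℤ, |j| ≤ B → theta τ (lam k - lam p + j * γ) ≠ 0

namespace ThetaGeneric

variable {N B : ℕ} {τ γ : ℂ} {lam : Fin N → ℂ}

theorem mono (h : ThetaGeneric τ γ lam B) {C : ℕ} (hC : C ≤ B) : ThetaGeneric τ γ lam C where
  gamma_ne j h1 h2 := h.gamma_ne j h1 (by omega)
  lam_ne k p hkp j hj := h.lam_ne k p hkp j (by omega)

theorem shift (h : ThetaGeneric τ γ lam (B + 1)) (p : Fin N) :
    ThetaGeneric τ γ (lamShift γ lam p) B where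
  gamma_ne j h1 h2 := h.gamma_ne j h1 (by omega)
  lam_ne k q hkq j hj := by
    rw [abs_le] at hj
    obtain rfl | hpk := eq_or_ne p k
    · have := h.lam_ne p q hkq (j - 1) (by rw [abs_le]; push_cast; omega)
      rw [lamShift_self, lamShift_of_ne γ lam hkq]
      convert this using 2
      push_cast
      ring
    obtain rfl | hpq := eq_or_ne p q
    · have := h.lam_ne k p hkq (j + 1) (by rw [abs_le]; push_cast; omega)
      rw [lamShift_self, lamShift_of_ne γ lam hpk]
      convert this using 2
      push_cast
      ring
    · rw [lamShift_of_ne γ lam hpk, lamShift_of_ne γ lam hpq]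
      exact h.lam_ne k q hkq j (by rw [abs_le]; push_cast; omega)

theorem sub_ne (h : ThetaGeneric τ γ lam B) {k p : Fin N} (hkp : k ≠ p) :
    theta τ (lam k - lam p) ≠ 0 := by
  simpa using h.lam_ne k p hkp 0 (by simp)

theorem sub_add_ne (h : ThetaGeneric τ γ lam (B + 1)) {k p : Fin N} (hkp : k ≠ p) :
    theta τ (lam k - lam p + γ) ≠ 0 := by
  simpa using h.lam_ne k p hkp 1 (by simp)

theorem sub_sub_ne (h : ThetaGeneric τ γ lam (B + 1)) {k p : Fin N} (hkp : k ≠ p) :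
    theta τ (lam k - lam p - γ) ≠ 0 := by
  simpa [sub_eq_add_neg] using h.lam_ne k p hkp (-1) (by simp)

theorem natCast_add_one_ne (h : ThetaGeneric τ γ lam B) {j : ℕ} (hj : j ≤ B) :
    theta τ ((j + 1) * γ) ≠ 0 := by
  simpa using h.gamma_ne (j + 1) (by omega) (by omega)

theorem theta_gamma_ne (h : ThetaGeneric τ γ lam B) : theta τ γ ≠ 0 := by
  simpa using h.gamma_ne 1 le_rfl (by omega)

end ThetaGeneric

/-- The coefficient by which the `L`-operator at `z = -γ` sends `e_k ⊗ s_m` to a multiple of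
`s_{m + ω_k}`, where `s_m` is the sum of the basis tensors of content `m` in `(ℂ^N)^{⊗n}`. -/
def orbitCoeff {N : ℕ} (τ γ : ℂ) (n : ℕ) (k : Fin N) (m : Fin N → ℤ) (lam : Fin N → ℂ) : ℂ :=
  theta τ ((m k + 1) * γ) / theta τ ((n + 1) * γ) *
    ∏ p ∈ Finset.univ.erase k, theta τ (lam k - lam p + m p * γ) / theta τ (lam k - lam p)

theorem orbitCoeff_succ_of_ne {N n : ℕ} {τ γ : ℂ} (hτ : 0 < τ.im) {lam : Fin N → ℂ}
    (hg : ThetaGeneric τ γ lam (n + 1)) {k p : Fin N} (hkp : k ≠ p) (m : Fin N → ℤ) :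
    orbitCoeff τ γ (n + 1) k m lam = alphaF τ γ (-((n + 1) * γ)) (lam k - lam p) *
      orbitCoeff τ γ n k (m - Pi.single p 1) (lamShift γ lam p) := by
  have hp : p ∈ (Finset.univ.erase k : Finset (Fin N)) := by simp [hkp.symm]
  have h1 := hg.sub_ne hkp
  have h2 := hg.sub_add_ne hkp
  have h3 := hg.natCast_add_one_ne (j := n) (by omega)
  have h4 := hg.natCast_add_one_ne (j := n + 1) le_rfl
  rw [orbitCoeff, orbitCoeff, ← Finset.mul_prod_erase _ _ hp, ← Finset.mul_prod_erase _ _ hp,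
    alphaF, show -((n + 1) * γ) - γ = -(((n + 1 : ℕ) + 1) * γ) by push_cast; ring, theta_neg hτ,
    theta_neg hτ, lamShift_self, lamShift_of_ne γ lam hkp.symm]
  have hprod : ∏ q ∈ (Finset.univ.erase k).erase p,
        theta τ (lam k - lamShift γ lam p q + ((m - Pi.single p 1 : Fin N → ℤ) q : ℤ) * γ) /
          theta τ (lam k - lamShift γ lam p q) =
      ∏ q ∈ (Finset.univ.erase k).erase p,
        theta τ (lam k - lam q + m q * γ) / theta τ (lam k - lam q) := by
    refine Finset.prod_congr rfl fun q hq => ?_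
    have hqp : q ≠ p := (Finset.mem_erase.1 hq).1
    simp [lamShift_of_ne γ lam hqp.symm, hqp]
  rw [hprod, show lam k - (lam p - γ) = lam k - lam p + γ by ring]
  simp only [Pi.sub_apply, Pi.single_eq_same, Pi.single_eq_of_ne hkp, Int.cast_sub, Int.cast_one,
    sub_zero]
  rw [show lam k - lam p + γ + ((m p : ℂ) - 1) * γ = lam k - lam p + m p * γ by ring]
  generalize theta τ (((n + 1 : ℕ) + 1) * γ) = A at *
  generalize theta τ ((n + 1) * γ) = B at *
  field_simp

/-- The points used to specialise the partial fraction identity. -/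
def pfPoint {N : ℕ} (γ : ℂ) (lam : Fin N → ℂ) (k : Fin N) : Option (Fin N) → ℂ
  | none => lam k - γ
  | some p => lam p

/-- The zeros used to specialise the partial fraction identity. -/
def pfZero {N : ℕ} (γ : ℂ) (n : ℕ) (m : Fin N → ℤ) (lam : Fin N → ℂ) (k : Fin N) :
    Option (Fin N) → ℂ
  | none => lam k + (n + 1) * γ
  | some p => lam p - m p * γ - if p = k then γ else 0

theorem prod_erase_some {N : ℕ} (k : Fin N) (f : Option (Fin N) → ℂ) :
    ∏ j ∈ Finset.univ.erase (some k), f j =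
      f none * ∏ p ∈ Finset.univ.erase k, f (some p) := by
  have : (Finset.univ.erase (some k) : Finset (Option (Fin N))) =
      Finset.insertNone (Finset.univ.erase k) := by
    ext (_ | j) <;> simp
  rw [this, Finset.prod_insertNone]

theorem prod_erase_none {N : ℕ} (f : Option (Fin N) → ℂ) :
    ∏ j ∈ Finset.univ.erase none, f j = ∏ p : Fin N, f (some p) := by
  have : (Finset.univ.erase none : Finset (Option (Fin N))) =
      Finset.univ.map Function.Embedding.some := by
    ext (_ | j) <;> simp
  rw [this, Finset.prod_map]
  rfl

theorem orbitCoeff_succ_self {N n : ℕ} {τ γ : ℂ} (hτ : 0 < τ.im) {lam : Fin N → ℂ}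
    (hg : ThetaGeneric τ γ lam (n + 1)) (k : Fin N) {m : Fin N → ℤ} (hm : ∑ i, m i = n + 1) :
    orbitCoeff τ γ (n + 1) k m lam =
      orbitCoeff τ γ n k (m - Pi.single k 1) (lamShift γ lam k) +
      ∑ l ∈ Finset.univ.erase k, betaF τ γ (-((n + 1) * γ)) (lam l - lam k) *
        orbitCoeff τ γ n l (m - Pi.single l 1) (lamShift γ lam k) := by
  have hγ := hg.theta_gamma_ne
  have h3 := hg.natCast_add_one_ne (j := n) (by omega)
  have h4 := hg.natCast_add_one_ne (j := n + 1) le_rfl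
  have hsum : ∑ i, pfPoint γ lam k i = ∑ i, pfZero γ n m lam k i := by
    have hm' : ∑ i, (m i : ℂ) = n + 1 := by exact_mod_cast hm
    rw [Fintype.sum_option, Fintype.sum_option]
    simp only [pfPoint, pfZero, Finset.sum_sub_distrib, ← Finset.sum_mul, hm', Finset.sum_ite_eq',
      Finset.mem_univ, if_true]
    ring
  have hne : ∀ i ∈ Finset.univ, ∀ j ∈ Finset.univ, i ≠ j →
      theta τ (pfPoint γ lam k i - pfPoint γ lam k j) ≠ 0 := by
    have hk : ∀ p, theta τ (lam k - γ - lam p) ≠ 0 := fun p => by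
      obtain rfl | hkp := eq_or_ne k p
      · rw [show lam k - γ - lam k = -γ by ring, theta_neg hτ]
        exact neg_ne_zero.2 hγ
      · rw [sub_right_comm]
        exact hg.sub_sub_ne hkp
    rintro (_ | i) - (_ | j) - hij
    · exact absurd rfl hij
    · exact hk j
    · simp only [pfPoint]
      rw [← neg_sub, theta_neg hτ]
      exact neg_ne_zero.2 (hk i)
    · exact hg.sub_ne fun h => hij (congrArg some h)
  have key := thetaSum_eq_zero hτ Finset.univ hne hsum
  rw [thetaSum, Fintype.sum_option, ← Finset.add_sum_erase _ _ (Finset.mem_univ k)] at key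
  set K := theta τ (((n + 1 : ℕ) + 1) * γ) * theta τ ((n + 1) * γ) / theta τ γ with hK
  have hK0 : K ≠ 0 := div_ne_zero (mul_ne_zero h4 h3) hγ
  have hTk : (∏ j, theta τ (pfPoint γ lam k (some k) - pfZero γ n m lam k j)) /
      ∏ j ∈ Finset.univ.erase (some k), theta τ (pfPoint γ lam k (some k) - pfPoint γ lam k j) =
      -(K * orbitCoeff τ γ (n + 1) k m lam) := by
    rw [prod_erase_some, Fintype.prod_option, ← Finset.mul_prod_erase _ _ (Finset.mem_univ k)]
    have hprod : ∏ p ∈ Finset.univ.erase k,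
        theta τ (pfPoint γ lam k (some k) - pfZero γ n m lam k (some p)) =
        ∏ p ∈ Finset.univ.erase k, theta τ (lam k - lam p + m p * γ) := by
      refine Finset.prod_congr rfl fun p hp => ?_
      simp only [pfPoint, pfZero, if_neg (Finset.mem_erase.1 hp).1]
      congr 1
      ring
    rw [hprod, orbitCoeff, Finset.prod_div_distrib]
    simp only [pfPoint, pfZero, if_true]
    have hden : ∏ p ∈ Finset.univ.erase k, theta τ (lam k - lam p) ≠ 0 :=
      Finset.prod_ne_zero_iff.2 fun p hp => hg.sub_ne (Finset.mem_erase.1 hp).1.symm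
    rw [show lam k - (lam k + (n + 1) * γ) = -((n + 1) * γ) by ring, theta_neg hτ,
      show lam k - (lam k - γ) = γ by ring,
      show lam k - (lam k - m k * γ - γ) = (m k + 1) * γ by ring, hK]
    generalize theta τ (((n + 1 : ℕ) + 1) * γ) = A at *
    generalize theta τ ((n + 1) * γ) = B at *
    generalize ∏ p ∈ Finset.univ.erase k, theta τ (lam k - lam p + m p * γ) = C at *
    field_simp
  have hTn : (∏ j, theta τ (pfPoint γ lam k none - pfZero γ n m lam k j)) /
      ∏ j ∈ Finset.univ.erase none, theta τ (pfPoint γ lam k none - pfPoint γ lam k j) =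
      K * orbitCoeff τ γ n k (m - Pi.single k 1) (lamShift γ lam k) := by
    rw [prod_erase_none, Fintype.prod_option, ← Finset.mul_prod_erase _ _ (Finset.mem_univ k),
      ← Finset.mul_prod_erase _ _ (Finset.mem_univ k)]
    have hprod : ∏ p ∈ Finset.univ.erase k,
        theta τ (pfPoint γ lam k none - pfZero γ n m lam k (some p)) =
        ∏ p ∈ Finset.univ.erase k, theta τ (lam k - γ - lam p + m p * γ) := by
      refine Finset.prod_congr rfl fun p hp => ?_
      simp only [pfPoint, pfZero, if_neg (Finset.mem_erase.1 hp).1]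
      congr 1
      ring
    have hprod' : ∏ p ∈ Finset.univ.erase k,
        theta τ (lamShift γ lam k k - lamShift γ lam k p +
            ((m - Pi.single k 1 : Fin N → ℤ) p : ℤ) * γ) /
          theta τ (lamShift γ lam k k - lamShift γ lam k p) =
        (∏ p ∈ Finset.univ.erase k, theta τ (lam k - γ - lam p + m p * γ)) /
          ∏ p ∈ Finset.univ.erase k, theta τ (lam k - γ - lam p) := by
      rw [← Finset.prod_div_distrib]
      refine Finset.prod_congr rfl fun p hp => ?_
      have hpk : p ≠ k := (Finset.mem_erase.1 hp).1
      simp [lamShift_of_ne γ lam hpk.symm, lamShift_self, hpk]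
    rw [hprod, orbitCoeff, hprod']
    simp only [pfPoint, pfZero, if_true, Pi.sub_apply, Pi.single_eq_same, Int.cast_sub,
      Int.cast_one, sub_add_cancel]
    have hden : ∏ p ∈ Finset.univ.erase k, theta τ (lam k - γ - lam p) ≠ 0 :=
      Finset.prod_ne_zero_iff.2 fun p hp => by
        rw [sub_right_comm]
        exact hg.sub_sub_ne (Finset.mem_erase.1 hp).1.symm
    rw [show lam k - γ - (lam k + (n + 1) * γ) = -(((n + 1 : ℕ) + 1) * γ) by push_cast; ring,
      theta_neg hτ, show lam k - γ - lam k = -γ by ring, theta_neg hτ,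
      show lam k - γ - (lam k - m k * γ - γ) = m k * γ by ring, hK]
    generalize theta τ (((n + 1 : ℕ) + 1) * γ) = A at *
    generalize theta τ ((n + 1) * γ) = B at *
    field_simp
  have hTl : ∀ l ∈ Finset.univ.erase k,
      (∏ j, theta τ (pfPoint γ lam k (some l) - pfZero γ n m lam k j)) /
      ∏ j ∈ Finset.univ.erase (some l), theta τ (pfPoint γ lam k (some l) - pfPoint γ lam k j) =
      K * (betaF τ γ (-((n + 1) * γ)) (lam l - lam k) *
        orbitCoeff τ γ n l (m - Pi.single l 1) (lamShift γ lam k)) := by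
    intro l hl
    have hlk : l ≠ k := (Finset.mem_erase.1 hl).1
    have hk : k ∈ (Finset.univ.erase l : Finset (Fin N)) := by simp [hlk.symm]
    rw [prod_erase_some, Fintype.prod_option, ← Finset.mul_prod_erase _ _ (Finset.mem_univ l),
      ← Finset.mul_prod_erase _ _ hk, ← Finset.mul_prod_erase _ _ hk]
    have hprod : ∏ p ∈ (Finset.univ.erase l).erase k,
        theta τ (pfPoint γ lam k (some l) - pfZero γ n m lam k (some p)) =
        ∏ p ∈ (Finset.univ.erase l).erase k, theta τ (lam l - lam p + m p * γ) := by
      refine Finset.prod_congr rfl fun p hp => ?_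
      simp only [pfPoint, pfZero, if_neg (Finset.mem_erase.1 hp).1]
      congr 1
      ring
    have hprod' : ∏ p ∈ (Finset.univ.erase l).erase k,
        theta τ (lam l - lamShift γ lam k p + ((m - Pi.single l 1 : Fin N → ℤ) p : ℤ) * γ) /
          theta τ (lam l - lamShift γ lam k p) =
        (∏ p ∈ (Finset.univ.erase l).erase k, theta τ (lam l - lam p + m p * γ)) /
          ∏ p ∈ (Finset.univ.erase l).erase k, theta τ (lam l - lam p) := by
      rw [← Finset.prod_div_distrib]
      refine Finset.prod_congr rfl fun p hp => ?_
      have hpk : p ≠ k := (Finset.mem_erase.1 hp).1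
      have hpl : p ≠ l := (Finset.mem_erase.1 (Finset.mem_erase.1 hp).2).1
      simp [lamShift_of_ne γ lam hpk.symm, hpl]
    rw [hprod, orbitCoeff, ← Finset.mul_prod_erase _ _ hk, lamShift_of_ne γ lam hlk.symm, hprod',
      lamShift_self, betaF]
    simp only [pfPoint, pfZero, if_true, if_neg hlk, Pi.sub_apply, Pi.single_eq_same,
      Pi.single_eq_of_ne hlk.symm, Int.cast_sub, Int.cast_one, sub_add_cancel, sub_zero]
    have hden : ∏ p ∈ (Finset.univ.erase l).erase k, theta τ (lam l - lam p) ≠ 0 :=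
      Finset.prod_ne_zero_iff.2 fun p hp =>
        hg.sub_ne (Finset.mem_erase.1 (Finset.mem_erase.1 hp).2).1.symm
    have h5 := hg.sub_ne hlk
    have h6 := hg.sub_add_ne hlk
    rw [show lam l - (lam k + (n + 1) * γ) = -((n + 1) * γ) + (lam l - lam k) by ring,
      show -((n + 1) * γ) - γ = -(((n + 1 : ℕ) + 1) * γ) by push_cast; ring, theta_neg hτ,
      show lam l - (lam l - m l * γ) = m l * γ by ring,
      show lam l - (lam k - γ) = lam l - lam k + γ by ring,
      show lam l - (lam k - m k * γ - γ) = lam l - lam k + γ + m k * γ by ring, hK]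
    generalize theta τ (((n + 1 : ℕ) + 1) * γ) = A at *
    generalize theta τ ((n + 1) * γ) = B at *
    field_simp
  rw [hTk, hTn, Finset.sum_congr rfl hTl, ← Finset.mul_sum] at key
  apply mul_left_cancel₀ hK0
  linear_combination -key

/-- The content of `f`: the number of occurrences of each basis index. -/
def content {N n : ℕ} (f : Fin n → Fin N) : Fin N → ℤ := ∑ c, Pi.single (f c) 1

theorem content_snoc {N n : ℕ} (h : Fin n → Fin N) (p : Fin N) :
    content (Fin.snoc h p : Fin (n + 1) → Fin N) = content h + Pi.single p 1 := by
  simp [content, Fin.sum_univ_castSucc]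

theorem content_eq_head_add_tail {N n : ℕ} (f : Fin (n + 1) → Fin N) :
    content f = Pi.single (f 0) 1 + content (Fin.tail f) := by
  simp [content, Fin.sum_univ_succ, Fin.tail]

theorem content_comp_perm {N n : ℕ} (f : Fin n → Fin N) (σ : Equiv.Perm (Fin n)) :
    content (f ∘ σ) = content f :=
  Equiv.sum_comp σ fun c => (Pi.single (f c) 1 : Fin N → ℤ)

theorem sum_content {N n : ℕ} (f : Fin n → Fin N) : ∑ i, content f i = n := by
  simp only [content, Finset.sum_apply]
  rw [Finset.sum_comm]
  simp

theorem content_apply {N n : ℕ} (f : Fin n → Fin N) (i : Fin N) :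
    content f i = Fintype.card {c // f c = i} := by
  rw [content, Finset.sum_apply, Fintype.card_subtype, Finset.card_filter]
  push_cast
  exact Finset.sum_congr rfl fun c _ => by simp [Pi.single_apply, eq_comm]

theorem exists_perm_of_content_eq {N n : ℕ} {f g : Fin n → Fin N} (h : content f = content g) :
    ∃ σ : Equiv.Perm (Fin n), g = f ∘ σ := by
  have e : ∀ i, Nonempty ({c // g c = i} ≃ {c // f c = i}) := fun i => by
    refine Fintype.card_eq.1 ?_
    exact_mod_cast (content_apply g i).symm.trans ((congrFun h i).symm.trans (content_apply f i))
  exact ⟨Equiv.ofFiberEquiv fun i => (e i).some,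
    funext fun c => (Equiv.ofFiberEquiv_map (fun i => (e i).some) c).symm⟩

/-- The sum of the basis tensors of content `m` whose first factor is `e_k`. -/
def headVec {N : ℕ} (n : ℕ) (k : Fin N) (m : Fin N → ℤ) : (Fin (n + 1) → Fin N) → ℂ := fun f =>
  if f 0 = k ∧ content f = m then 1 else 0

theorem Rop_empty_apply {N n : ℕ} (τ γ z : ℂ) (lam : Fin N → ℂ) (a b : Fin n)
    (f g : Fin n → Fin N) :
    Rop N n τ γ z lam ∅ a b f g = if f a = f b then (if g = f then 1 else 0) else
      (if g = f then alphaF τ γ z (lam (f a) - lam (f b)) else 0) +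
      (if g = f ∘ Equiv.swap a b then betaF τ γ z (lam (f a) - lam (f b)) else 0) := by
  have hs : shiftL γ lam ∅ g = lam := by funext i; simp [shiftL]
  rw [Rop, hs]
  have hgf : g = f ↔ (∀ c, c ≠ a → c ≠ b → f c = g c) ∧ g a = f a ∧ g b = f b := by
    refine ⟨by rintro rfl; simp, fun ⟨h, ha, hb⟩ => funext fun c => ?_⟩
    by_cases hca : c = a
    · rw [hca, ha]
    by_cases hcb : c = b
    · rw [hcb, hb]
    exact (h c hca hcb).symm
  have hgs : g = f ∘ Equiv.swap a b ↔
      (∀ c, c ≠ a → c ≠ b → f c = g c) ∧ g a = f b ∧ g b = f a := by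
    refine ⟨?_, fun ⟨h, ha, hb⟩ => funext fun c => ?_⟩
    · rintro rfl
      refine ⟨fun c hca hcb => ?_, by simp, by simp⟩
      simp [Equiv.swap_apply_of_ne_of_ne hca hcb]
    by_cases hca : c = a
    · simp [hca, ha]
    by_cases hcb : c = b
    · simp [hcb, hb]
    simp [Equiv.swap_apply_of_ne_of_ne hca hcb, h c hca hcb]
  by_cases h : ∀ c, c ≠ a → c ≠ b → f c = g c
  · rw [if_pos h]
    simp only [Rmat, hgf, hgs, Prod.mk.injEq, and_iff_right h]
  · rw [if_neg h]
    simp [hgf, hgs, h]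

theorem Rop_empty_mulVec {N n : ℕ} (τ γ z : ℂ) (lam : Fin N → ℂ) (a b : Fin n)
    (v : (Fin n → Fin N) → ℂ) (f : Fin n → Fin N) :
    (Rop N n τ γ z lam ∅ a b *ᵥ v) f = if f a = f b then v f else
      alphaF τ γ z (lam (f a) - lam (f b)) * v f +
      betaF τ γ z (lam (f a) - lam (f b)) * v (f ∘ Equiv.swap a b) := by
  simp only [Matrix.mulVec, dotProduct, Rop_empty_apply τ γ z lam a b]
  split_ifs
  · simp
  · simp [add_mul, Finset.sum_add_distrib]

/-- `∑_p M_p ⊗ E_{pp}` on `(ℂ^N)^{⊗n} ⊗ ℂ^N`. -/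
def snocBlock {N n : ℕ} (M : Fin N → Matrix (Fin n → Fin N) (Fin n → Fin N) ℂ) :
    Matrix (Fin (n + 1) → Fin N) (Fin (n + 1) → Fin N) ℂ := fun f g =>
  if f (Fin.last n) = g (Fin.last n) then M (g (Fin.last n)) (Fin.init f) (Fin.init g) else 0

theorem snocBlock_mulVec {N n : ℕ} (M : Fin N → Matrix (Fin n → Fin N) (Fin n → Fin N) ℂ)
    (v : (Fin (n + 1) → Fin N) → ℂ) (h : Fin n → Fin N) (p : Fin N) :
    (snocBlock M *ᵥ v) (Fin.snoc h p) = (M p *ᵥ fun h' => v (Fin.snoc h' p)) h := by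
  simp only [Matrix.mulVec, dotProduct, snocBlock]
  rw [← (Fin.snocEquiv fun _ : Fin (n + 1) => Fin N).sum_comp, Fintype.sum_prod_type,
    Finset.sum_eq_single p]
  · simp [Fin.snocEquiv]
  · intro q _ hq
    simp [Fin.snocEquiv, hq.symm]
  · simp

theorem prod_map_snocBlock_mulVec {ι : Type*} {N n : ℕ} (L : List ι)
    (M : ι → Fin N → Matrix (Fin n → Fin N) (Fin n → Fin N) ℂ)
    (v : (Fin (n + 1) → Fin N) → ℂ) (h : Fin n → Fin N) (p : Fin N) :
    ((L.map fun j => snocBlock (M j)).prod *ᵥ v) (Fin.snoc h p) =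
      ((L.map fun j => M j p).prod *ᵥ fun h' => v (Fin.snoc h' p)) h := by
  induction L generalizing h with
  | nil => simp
  | cons j L ih =>
    simp only [List.map_cons, List.prod_cons, ← Matrix.mulVec_mulVec, snocBlock_mulVec, ih]

theorem shiftL_castSucc {N n : ℕ} (γ : ℂ) (lam : Fin N → ℂ) (j : Fin n)
    (g : Fin (n + 1) → Fin N) :
    shiftL γ lam (Finset.univ.filter fun c => j.castSucc < c) g =
      shiftL γ (lamShift γ lam (g (Fin.last n))) (Finset.univ.filter fun c => j < c)
        (Fin.init g) := by
  funext i
  have hcard : ((Finset.univ.filter fun c => j.castSucc < c).filter fun c => g c = i).card =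
      ((Finset.univ.filter fun c => j < c).filter fun c => Fin.init g c = i).card +
        if g (Fin.last n) = i then 1 else 0 := by
    rw [Finset.filter_filter, Finset.filter_filter, Finset.card_filter, Finset.card_filter,
      Fin.sum_univ_castSucc]
    simp only [Fin.castSucc_lt_castSucc_iff, Fin.castSucc_lt_last, true_and]
    rfl
  simp only [shiftL, lamShift, hcard]
  push_cast
  split_ifs <;> ring

theorem Rop_castSucc {N n : ℕ} (τ γ z : ℂ) (lam : Fin N → ℂ) (j : Fin n) :
    Rop N (n + 2) τ γ z lam (Finset.univ.filter fun c => j.castSucc.succ < c) 0 j.castSucc.succ =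
      snocBlock fun p => Rop N (n + 1) τ γ z (lamShift γ lam p)
        (Finset.univ.filter fun c => j.succ < c) 0 j.succ := by
  funext f g
  rw [Fin.succ_castSucc, ← Fin.castSucc_zero, Rop, snocBlock, Rop, shiftL_castSucc]
  have hiff : (∀ c : Fin (n + 2), c ≠ Fin.castSucc 0 → c ≠ j.succ.castSucc → f c = g c) ↔
      f (Fin.last _) = g (Fin.last _) ∧
        ∀ c : Fin (n + 1), c ≠ 0 → c ≠ j.succ → Fin.init f c = Fin.init g c := by
    refine ⟨fun H => ⟨H _ (Fin.castSucc_lt_last _).ne' (Fin.castSucc_lt_last _).ne',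
      fun c h0 hj => H c.castSucc (by simpa using h0)
        fun h => hj (Fin.castSucc_injective _ h)⟩, ?_⟩
    rintro ⟨hl, H⟩ c
    refine Fin.lastCases (fun _ _ => hl) (fun c h0 hj => ?_) c
    exact H c (fun h => h0 (h ▸ rfl)) fun h => hj (h ▸ rfl)
  simp only [hiff, ite_and]
  rfl

/-- `R(-γ, λ - γ∑_{j≥2} h^{(j)})^{(01)} ⋯ R(-nγ, λ)^{(0n)}`. -/
def fusedL {N : ℕ} (τ γ : ℂ) (n : ℕ) (lam : Fin N → ℂ) :
    Matrix (Fin (n + 1) → Fin N) (Fin (n + 1) → Fin N) ℂ :=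
  ((List.finRange n).map fun j : Fin n =>
    Rop N (n + 1) τ γ (-(((j : ℕ) + 1) * γ)) lam
      (Finset.univ.filter fun c : Fin (n + 1) => j.succ < c) 0 j.succ).prod

theorem fusedL_succ_mulVec {N : ℕ} (τ γ : ℂ) (n : ℕ) (lam : Fin N → ℂ)
    (v : (Fin (n + 2) → Fin N) → ℂ) (h : Fin (n + 1) → Fin N) (p : Fin N) :
    (fusedL τ γ (n + 1) lam *ᵥ v) (Fin.snoc h p) =
      (fusedL τ γ n (lamShift γ lam p) *ᵥ fun h' =>
        (Rop N (n + 2) τ γ (-((n + 1) * γ)) lam ∅ 0 (Fin.last _) *ᵥ v) (Fin.snoc h' p)) h := by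
  have hS : (Finset.univ.filter fun c : Fin (n + 2) => Fin.last (n + 1) < c) = ∅ := by
    simp [Finset.filter_eq_empty_iff, Fin.le_last]
  rw [fusedL, List.finRange_succ_last, List.map_append, List.prod_append, ← Matrix.mulVec_mulVec,
    List.map_map]
  simp only [Function.comp_def, Rop_castSucc, Fin.val_castSucc]
  rw [prod_map_snocBlock_mulVec]
  simp only [List.map_cons, List.map_nil, List.prod_singleton, Fin.succ_last, Fin.val_last, hS]
  rfl

theorem fusedL_mulVec_headVec {N n : ℕ} {τ γ : ℂ} (hτ : 0 < τ.im) {lam : Fin N → ℂ}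
    (hg : ThetaGeneric τ γ lam n) (k : Fin N) {m : Fin N → ℤ} (hm : ∑ i, m i = n + 1)
    (f : Fin (n + 1) → Fin N) :
    (fusedL τ γ n lam *ᵥ headVec n k m) f =
      if content f = m then orbitCoeff τ γ n k (m - Pi.single k 1) lam else 0 := by
  induction n generalizing lam k m with
  | zero =>
    have hf : content f = Pi.single (f 0) 1 := by simp [content]
    simp only [fusedL, List.finRange_zero, List.map_nil, List.prod_nil, Matrix.one_mulVec, headVec]
    obtain rfl | hk := eq_or_ne (f 0) k
    · by_cases hfm : content f = m
      · have hprod : ∏ p ∈ Finset.univ.erase (f 0),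
            theta τ (lam (f 0) - lam p) / theta τ (lam (f 0) - lam p) = 1 :=
          Finset.prod_eq_one fun p hp => div_self (hg.sub_ne (Finset.mem_erase.1 hp).1.symm)
        simp [hfm, ← hf, orbitCoeff, hprod, hg.theta_gamma_ne]
      · simp [hfm]
    · by_cases hfm : content f = m
      · have hmk : m k = 0 := by rw [← hfm, hf, Pi.single_eq_of_ne hk.symm]
        simp [hfm, hk, orbitCoeff, hmk, theta_zero hτ]
      · simp [hfm]
  | succ n ih =>
    obtain ⟨h, p, rfl⟩ : ∃ h p, f = Fin.snoc h p := ⟨Fin.init f, f (Fin.last _), by simp⟩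
    have hm' : ∀ q, ∑ i, (m - Pi.single q 1 : Fin N → ℤ) i = n + 1 := fun q => by
      simp only [Pi.sub_apply, Finset.sum_sub_distrib, hm]
      simp
    have h0 : ∀ h' : Fin (n + 1) → Fin N, (Fin.snoc h' p : Fin (n + 2) → Fin N) 0 = h' 0 :=
      fun h' => by rw [← Fin.castSucc_zero, Fin.snoc_castSucc (α := fun _ => Fin N)]
    have hc : ∀ h' : Fin (n + 1) → Fin N,
        content (Fin.snoc h' p : Fin (n + 2) → Fin N) = m ↔ content h' = m - Pi.single p 1 :=
      fun h' => by rw [content_snoc, eq_sub_iff_add_eq]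
    rw [fusedL_succ_mulVec]
    simp only [Rop_empty_mulVec, headVec, content_comp_perm, hc, h0,
      Function.comp_apply, Equiv.swap_apply_left, Fin.snoc_last]
    obtain rfl | hkp := eq_or_ne k p
    · have hv : (fun h' : Fin (n + 1) → Fin N => if h' 0 = k then
            (if h' 0 = k ∧ content h' = m - Pi.single k 1 then (1 : ℂ) else 0) else
          alphaF τ γ (-((n + 1) * γ)) (lam (h' 0) - lam k) *
              (if h' 0 = k ∧ content h' = m - Pi.single k 1 then 1 else 0) +
            betaF τ γ (-((n + 1) * γ)) (lam (h' 0) - lam k) *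
              (if k = k ∧ content h' = m - Pi.single k 1 then 1 else 0)) =
          headVec n k (m - Pi.single k 1) + ∑ l ∈ Finset.univ.erase k,
            betaF τ γ (-((n + 1) * γ)) (lam l - lam k) • headVec n l (m - Pi.single k 1) := by
        funext h'
        simp only [Pi.add_apply, Finset.sum_apply, Pi.smul_apply, headVec, smul_eq_mul]
        by_cases hk : h' 0 = k
        · rw [Finset.sum_eq_zero fun l hl => by
            rw [hk, if_neg fun h => (Finset.mem_erase.1 hl).1 h.1.symm, mul_zero]]
          simp [hk]
        · rw [Finset.sum_eq_single_of_mem (h' 0) (by simp [hk]) fun l _ hl => by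
            rw [if_neg fun h => hl h.1.symm, mul_zero]]
          simp [hk]
      rw [hv, Matrix.mulVec_add, Matrix.mulVec_sum]
      simp only [Matrix.mulVec_smul, Pi.add_apply, Finset.sum_apply, Pi.smul_apply, smul_eq_mul,
        ih (hg.shift k) _ (hm' k)]
      rw [orbitCoeff_succ_self hτ hg k (by exact_mod_cast hm' k)]
      split_ifs <;> simp
    · have hv : (fun h' : Fin (n + 1) → Fin N => if h' 0 = p then
            (if h' 0 = k ∧ content h' = m - Pi.single p 1 then (1 : ℂ) else 0) else
          alphaF τ γ (-((n + 1) * γ)) (lam (h' 0) - lam p) *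
              (if h' 0 = k ∧ content h' = m - Pi.single p 1 then 1 else 0) +
            betaF τ γ (-((n + 1) * γ)) (lam (h' 0) - lam p) *
              (if p = k ∧ content h' = m - Pi.single p 1 then 1 else 0)) =
          alphaF τ γ (-((n + 1) * γ)) (lam k - lam p) • headVec n k (m - Pi.single p 1) := by
        funext h'
        simp only [Pi.smul_apply, headVec, smul_eq_mul]
        by_cases hk : h' 0 = k
        · simp [hk, hkp, hkp.symm]
        · simp [hk, hkp.symm]
      rw [hv, Matrix.mulVec_smul, Pi.smul_apply, ih (hg.shift p) _ (hm' p), smul_eq_mul,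
        orbitCoeff_succ_of_ne hτ hg hkp, sub_right_comm]
      split_ifs <;> simp

/-- The nonzero entries of the column `g` of `W^S_n(λ)`. -/
def columnCoeff {N : ℕ} (τ γ : ℂ) : (n : ℕ) → (Fin n → Fin N) → (Fin N → ℂ) → ℂ
  | 0, _, _ => 1
  | n + 1, g, lam => columnCoeff τ γ n (Fin.tail g) (lamShift γ lam (g 0)) *
      orbitCoeff τ γ n (g 0) (content (Fin.tail g)) lam

theorem content_nonneg {N n : ℕ} (f : Fin n → Fin N) (i : Fin N) : 0 ≤ content f i := by
  rw [content_apply]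
  positivity

theorem content_le {N n : ℕ} (f : Fin n → Fin N) (i : Fin N) : content f i ≤ n := by
  rw [content_apply]
  exact_mod_cast (Fintype.card_subtype_le _).trans (Fintype.card_fin n).le

theorem orbitCoeff_ne_zero {N n : ℕ} {τ γ : ℂ} {lam : Fin N → ℂ} (hg : ThetaGeneric τ γ lam n)
    (k : Fin N) {m : Fin N → ℤ} (h0 : ∀ i, 0 ≤ m i) (hn : ∀ i, m i ≤ n) :
    orbitCoeff τ γ n k m lam ≠ 0 := by
  refine mul_ne_zero (div_ne_zero ?_ (hg.natCast_add_one_ne le_rfl))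
    (Finset.prod_ne_zero_iff.2 fun p hp => ?_)
  · have hk := hg.natCast_add_one_ne (j := (m k).toNat) (by have := hn k; omega)
    rwa [← Int.cast_natCast, Int.toNat_of_nonneg (h0 k)] at hk
  · have hkp := (Finset.mem_erase.1 hp).1.symm
    exact div_ne_zero (hg.lam_ne k p hkp _ (by rw [abs_of_nonneg (h0 p)]; exact hn p))
      (hg.sub_ne hkp)

theorem columnCoeff_ne_zero {N n : ℕ} {τ γ : ℂ} {lam : Fin N → ℂ}
    (hg : ThetaGeneric τ γ lam n) (g : Fin n → Fin N) : columnCoeff τ γ n g lam ≠ 0 := by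
  induction n generalizing lam with
  | zero => exact one_ne_zero
  | succ n ih =>
    exact mul_ne_zero (ih (hg.shift _) _)
      (orbitCoeff_ne_zero (hg.mono n.le_succ) _ (content_nonneg _) (content_le _))

theorem Wrec_apply {N n : ℕ} {τ γ : ℂ} (hτ : 0 < τ.im) {lam : Fin N → ℂ}
    (hg : ThetaGeneric τ γ lam n) (w : ℂ) (f g : Fin n → Fin N) :
    Wrec N τ γ n (fun j => w + (j : ℕ) * γ) lam f g =
      if content f = content g then columnCoeff τ γ n g lam else 0 := by
  induction n generalizing lam w with
  | zero => simp [Wrec, columnCoeff, Subsingleton.elim f g, Matrix.one_apply]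
  | succ n ih =>
    have hz : ∀ j : Fin n, w + ((0 : Fin (n + 1)) : ℕ) * γ - (w + (j.succ : ℕ) * γ) =
        -(((j : ℕ) + 1) * γ) := fun j => by
      rw [Fin.val_zero, Fin.val_succ]
      push_cast
      ring
    have hs : (fun j : Fin n => w + (j.succ : ℕ) * γ) = fun j : Fin n => w + γ + (j : ℕ) * γ := by
      funext j
      rw [Fin.val_succ]
      push_cast
      ring
    have hcol : (fun h : Fin (n + 1) → Fin N => if h 0 = g 0 then
          Wrec N τ γ n (fun j : Fin n => w + γ + (j : ℕ) * γ) (lamShift γ lam (g 0))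
            (Fin.tail h) (Fin.tail g) else 0) =
        columnCoeff τ γ n (Fin.tail g) (lamShift γ lam (g 0)) •
          headVec n (g 0) (content g) := by
      funext h
      simp only [ih (hg.shift _), Pi.smul_apply, headVec, smul_eq_mul,
        content_eq_head_add_tail]
      by_cases h0 : h 0 = g 0
      · simp [h0]
      · simp [h0]
    have hm : ∑ i, content g i = n + 1 := by simpa using sum_content g
    have hcg : content g - Pi.single (g 0) 1 = content (Fin.tail g) := by
      rw [content_eq_head_add_tail, add_sub_cancel_left]
    simp only [Wrec, hz, hs, Matrix.mul_apply, Matrix.of_apply]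
    change (fusedL τ γ n lam *ᵥ fun h : Fin (n + 1) → Fin N => if h 0 = g 0 then
      Wrec N τ γ n (fun j : Fin n => w + γ + (j : ℕ) * γ) (lamShift γ lam (g 0))
        (Fin.tail h) (Fin.tail g) else 0) f = _
    rw [hcol, Matrix.mulVec_smul, Pi.smul_apply,
      fusedL_mulVec_headVec hτ (hg.mono n.le_succ) _ hm, hcg, smul_eq_mul, mul_ite, mul_zero]
    rfl

theorem range_mulVecLin_eq_symTensors {N n : ℕ}
    {M : Matrix (Fin n → Fin N) (Fin n → Fin N) ℂ} {c : (Fin n → Fin N) → ℂ}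
    (hc : ∀ g, c g ≠ 0) (hM : ∀ f g, M f g = if content f = content g then c g else 0) :
    LinearMap.range (Matrix.mulVecLin M) = symTensors N n := by
  ext v
  constructor
  · rintro ⟨u, rfl⟩ σ f
    simp only [Matrix.mulVecLin_apply, Matrix.mulVec, dotProduct, hM, content_comp_perm]
  · intro hv
    have hv' : ∀ f g, content f = content g → v g = v f := fun f g h => by
      obtain ⟨σ, rfl⟩ := exists_perm_of_content_eq h
      exact hv σ f
    let s : (Fin n → Fin N) → Finset (Fin n → Fin N) := fun g =>
      Finset.univ.filter fun f => content g = content f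
    refine ⟨fun g => v g / (c g * (s g).card), funext fun f => ?_⟩
    have hs : ((s f).card : ℂ) ≠ 0 :=
      Nat.cast_ne_zero.2 (Finset.card_ne_zero_of_mem (a := f) (by simp [s]))
    simp only [Matrix.mulVecLin_apply, Matrix.mulVec, dotProduct, hM, ite_mul, zero_mul]
    rw [← Finset.sum_filter]
    have : ∀ g ∈ s f, c g * (v g / (c g * (s g).card)) = v f / (s f).card := fun g hgf => by
      have hfg : content f = content g := (Finset.mem_filter.1 hgf).2
      rw [hv' f g hfg, show s g = s f by simp only [s, hfg], ← mul_div_assoc,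
        mul_div_mul_left _ _ (hc g)]
    rw [Finset.sum_congr rfl this, Finset.sum_const, nsmul_eq_mul, mul_div_cancel₀ _ hs]

theorem isOpen_dense_theta_ne_zero {τ : ℂ} (hτ : 0 < τ.im) {E ι : Type*} [NormedAddCommGroup E]
    [NormedSpace ℂ E] [FiniteDimensional ℂ E] [Finite ι] (l : ι → E →ₗ[ℂ] ℂ)
    (hl : ∀ i, l i ≠ 0) :
    IsOpen {x | ∀ i, theta τ (l i x) ≠ 0} ∧ Dense {x | ∀ i, theta τ (l i x) ≠ 0} := by
  have ho : ∀ i, IsOpen {x | theta τ (l i x) ≠ 0} := fun i =>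
    isOpen_ne_fun ((continuous_theta hτ).comp (l i).continuous_of_finiteDimensional)
      continuous_const
  have hd : ∀ i, Dense {x | theta τ (l i x) ≠ 0} := fun i =>
    (dense_theta_ne_zero hτ).preimage
      ((l i).isOpenMap_of_finiteDimensional (LinearMap.surjective (hl i)))
  have := FiniteDimensional.complete ℂ E
  rw [Set.ofPred_forall]
  exact ⟨isOpen_iInter_of_finite ho, dense_iInter_of_isOpen ho hd⟩

/-- The linear forms whose theta values occur in `ThetaGeneric`. -/
def genericForm (N B : ℕ) :
    Fin (B + 1) ⊕ {q : Fin N × Fin N // q.1 ≠ q.2} × Finset.Icc (-B : ℤ) B →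
      (ℂ × (Fin N → ℂ)) →ₗ[ℂ] ℂ
  | .inl j => ((j : ℕ) + 1 : ℂ) • LinearMap.fst ℂ ℂ (Fin N → ℂ)
  | .inr (q, j) => (LinearMap.proj (R := ℂ) (φ := fun _ : Fin N => ℂ) q.1.1 -
      LinearMap.proj (R := ℂ) (φ := fun _ : Fin N => ℂ) q.1.2) ∘ₗ LinearMap.snd ℂ ℂ (Fin N → ℂ) +
      ((j : ℤ) : ℂ) • LinearMap.fst ℂ ℂ (Fin N → ℂ)

theorem genericForm_ne_zero {N B : ℕ} (i) : genericForm N B i ≠ 0 := by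
  intro h
  obtain j | ⟨⟨⟨k, p⟩, hkp⟩, j⟩ := i
  · have h1 := LinearMap.congr_fun h (1, 0)
    simp only [genericForm, LinearMap.smul_apply, LinearMap.fst_apply, smul_eq_mul, mul_one,
      LinearMap.zero_apply] at h1
    exact Nat.cast_add_one_ne_zero _ h1
  · have h1 := LinearMap.congr_fun h (0, Pi.single k 1)
    simp [genericForm, Pi.single_eq_of_ne hkp.symm] at h1

theorem thetaGeneric_of_forall {N B : ℕ} {τ γ : ℂ} {lam : Fin N → ℂ}
    (h : ∀ i, theta τ (genericForm N B i (γ, lam)) ≠ 0) : ThetaGeneric τ γ lam B where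
  gamma_ne j h1 h2 := by
    have := h (.inl ⟨j - 1, by omega⟩)
    rw [← Nat.sub_add_cancel h1]
    simpa [genericForm] using this
  lam_ne k p hkp j hj := by
    simpa [genericForm] using h (.inr (⟨(k, p), hkp⟩, ⟨j, Finset.mem_Icc.2 (abs_le.1 hj)⟩))

/-- for generic `(γ,λ)` the image of `W^S_n(λ)` is `S^n(ℂ^N)`. -/
theorem image_WS (N : ℕ) (hN : 2 ≤ N) (τ : ℂ) (hτ : 0 < τ.im) (n : ℕ) (hn : 1 ≤ n) :
    ∃ U : Set (ℂ × (Fin N → ℂ)), IsOpen U ∧ Dense U ∧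
      ∀ γ : ℂ, ∀ lam : Fin N → ℂ, (γ, lam) ∈ U →
        LinearMap.range (Matrix.mulVecLin (WS N n τ γ lam)) = symTensors N n := by
  obtain ⟨ho, hd⟩ := isOpen_dense_theta_ne_zero hτ (genericForm N n) genericForm_ne_zero
  refine ⟨_, ho, hd, fun γ lam h => ?_⟩
  have hg := thetaGeneric_of_forall h
  refine range_mulVecLin_eq_symTensors (columnCoeff_ne_zero hg) fun f g => ?_
  simpa [WS] using Wrec_apply hτ hg 0 f g

end EllipticQG
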